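/- Let X be a Banach space and K a nonempty compact convex subset of X. Let P : X ⇉ X be a set-valued map with convex values, mid-point continuous at every x ∈ X, and satisfying x ∉ P(x) for all x ∈ X. Then the set of maximal elements of P over K is nonempty: there exists x̄ ∈ K with P(x̄) ∩ K = ∅. -/

import Mathlib

namespace Scarf

open Finset

/-- A finite set `σ` is dominant for the family of rank functions `r` if no element of `T`
lies strictly above the `i`-minimum of `σ` for every `i` simultaneously. -/
def Dominant {I T : Type*} (r : I → T → ℕ) (σ : Finset T) : Prop :=
  ∀ x, ∃ i, ∀ s ∈ σ, r i x ≤ r i s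

theorem Dominant.mono {I T : Type*} {r : I → T → ℕ} {σ τ : Finset T}
    (hτ : Dominant r τ) (h : σ ⊆ τ) :
    Dominant r σ := fun x => (hτ x).imp fun _ hi s hs => hi s (h hs)

/-- `y` is the `i`-largest element lying strictly above `m j` in the `j`-th order for all
`j ≠ i`. -/
def IsTop {I T : Type*} (r : I → T → ℕ) (m : I → T) (i : I) (y : T) : Prop :=
  (∀ j, j ≠ i → r j (m j) < r j y) ∧
    ∀ x, (∀ j, j ≠ i → r j (m j) < r j x) → r i x ≤ r i y

theorem exists_isTop {I T : Type*} [Fintype T] {r : I → T → ℕ} {m : I → T}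
    {i : I} {x : T}
    (hx : ∀ j, j ≠ i → r j (m j) < r j x) : ∃ y, IsTop r m i y := by
  classical
  obtain ⟨y, hy, hmax⟩ := Finset.exists_max_image
    (univ.filter fun x => ∀ j, j ≠ i → r j (m j) < r j x) (r i) ⟨x, by simpa using hx⟩
  simp only [mem_filter, mem_univ, true_and] at hy hmax
  exact ⟨y, hy, hmax⟩

theorem IsTop.unique {I T : Type*} {r : I → T → ℕ}
    (hr : ∀ i, Function.Injective (r i)) {m : I → T}
    {i : I} {y z : T} (hy : IsTop r m i y) (hz : IsTop r m i z) : y = z :=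
  hr i (le_antisymm (hz.2 _ hy.1) (hy.2 _ hz.1))

/-- A dominant set with one element less than the number of orders has two colliding minima,
and its dominant one-point extensions are obtained from these two indices. -/
theorem exists_extension_indices {I T : Type*} [Fintype I] [DecidableEq I] [DecidableEq T]
    [Nontrivial I] {r : I → T → ℕ}
    (hr : ∀ i, Function.Injective (r i)) {σ : Finset T} (hσ : Dominant r σ)
    (hcard : #σ + 1 = Fintype.card I) :
    ∃ m : I → T, (∀ i, m i ∈ σ) ∧ (∀ i, ∀ s ∈ σ, r i (m i) ≤ r i s) ∧
      ∃ a b, a ≠ b ∧ m a = m b ∧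
        (∀ y, (y ∉ σ ∧ Dominant r (insert y σ)) ↔ IsTop r m a y ∨ IsTop r m b y) ∧
        ∀ y, ¬ (IsTop r m a y ∧ IsTop r m b y) := by
  have hne : σ.Nonempty := by
    rw [← Finset.card_pos]
    have := Fintype.one_lt_card (α := I)
    omega
  choose m hmem hmin using fun i => Finset.exists_min_image σ (r i) hne
  have hsurj : ∀ s ∈ σ, ∃ i, m i = s := fun s hs => by
    obtain ⟨i, hi⟩ := hσ s
    exact ⟨i, hr i (le_antisymm (hmin i s hs) (hi _ (hmem i)))⟩
  obtain ⟨a, -, b, -, hab, hmab⟩ := Finset.exists_ne_map_eq_of_card_lt_of_maps_to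
    (s := (univ : Finset I)) (t := σ) (by rw [card_univ]; omega) (f := m)
    (fun i _ => hmem i)
  have hle : ∀ i y, (∀ j, j ≠ i → r j (m j) < r j y) → r i y ≤ r i (m i) := fun i y h => by
    obtain ⟨k, hk⟩ := hσ y
    by_cases hki : k = i
    · exact hki ▸ hk _ (hmem k)
    · exact absurd (hk _ (hmem k)) (not_le.2 (h k hki))
  have hext : ∀ i i' y, i' ≠ i → m i = m i' → IsTop r m i y →
      y ∉ σ ∧ Dominant r (insert y σ) := fun i i' y hi' hm hy => by
    refine ⟨fun hyσ => ?_, fun x => ?_⟩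
    · have h1 := hr i (le_antisymm (hle i y hy.1) (hmin i y hyσ))
      have h2 := hy.1 i' hi'
      rw [h1, hm] at h2
      exact lt_irrefl _ h2
    · by_cases hx : ∀ j, j ≠ i → r j (m j) < r j x
      · refine ⟨i, fun s hs => ?_⟩
        rcases mem_insert.1 hs with rfl | hs
        · exact hy.2 x hx
        · exact (hle i x hx).trans (hmin i s hs)
      · push Not at hx
        obtain ⟨j, hj, hjx⟩ := hx
        refine ⟨j, fun s hs => ?_⟩
        rcases mem_insert.1 hs with rfl | hs
        · exact hjx.trans (hy.1 j hj).le
        · exact hjx.trans (hmin j s hs)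
  refine ⟨m, hmem, hmin, a, b, hab, hmab, fun y => ⟨fun ⟨hyσ, hy⟩ => ?_, ?_⟩, fun y hy => ?_⟩
  · obtain ⟨i, hi⟩ := hy y
    set J : Finset I := univ.filter fun j => r j (m j) < r j y with hJ
    have hσJ : σ ⊆ J.image m := fun s hs => by
      obtain ⟨j, hj⟩ := hy s
      have h1 : m j = s :=
        hr j (le_antisymm (hmin j s hs) (hj _ (mem_insert_of_mem (hmem j))))
      have h2 : s ≠ y := fun h => hyσ (h ▸ hs)
      refine mem_image.2 ⟨j, ?_, h1⟩
      simp only [hJ, mem_filter, mem_univ, true_and, h1]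
      exact lt_of_le_of_ne (hj _ (mem_insert_self _ _)) fun h => h2 (hr j h)
    have hiJ : J ⊆ univ.erase i := fun j hj => by
      simp only [hJ, mem_filter, mem_univ, true_and] at hj
      refine mem_erase.2 ⟨?_, mem_univ _⟩
      rintro rfl
      exact absurd (hi _ (mem_insert_of_mem (hmem j))) (not_le.2 hj)
    have hc1 : #(univ.erase i) = #σ := by
      rw [card_erase_of_mem (mem_univ _), card_univ]; omega
    have hc2 : #σ ≤ #(J.image m) := card_le_card hσJ
    have hJeq : J = univ.erase i := eq_of_subset_of_card_le hiJ (by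
      rw [hc1]; exact hc2.trans card_image_le)
    have hinj : Set.InjOn m J := card_image_iff.1
      (le_antisymm card_image_le (by rw [hJeq] at hc2 ⊢; omega))
    have htop : IsTop r m i y := by
      refine ⟨fun j hj => ?_, fun x hx => ?_⟩
      · have : j ∈ J := by rw [hJeq]; simpa using hj
        simpa [hJ] using this
      · obtain ⟨k, hk⟩ := hy x
        by_cases hki : k = i
        · subst hki
          exact hk _ (mem_insert_self _ _)
        · exact absurd (hk _ (mem_insert_of_mem (hmem k))) (not_le.2 (hx k hki))
    by_cases hia : i = a
    · exact Or.inl (hia ▸ htop)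
    by_cases hib : i = b
    · exact Or.inr (hib ▸ htop)
    refine absurd (hinj ?_ ?_ hmab) hab <;> rw [hJeq] <;>
      simp [Ne.symm hia, Ne.symm hib]
  · rintro (h | h)
    · exact hext a b y hab.symm hmab h
    · exact hext b a y hab hmab.symm h
  · have h1 := hy.1.1 b hab.symm
    exact absurd (hle b y hy.2.1) (not_le.2 h1)

/-- The dominant sets with one more point that contain `σ` correspond to the added points. -/
theorem card_filter_dominant_superset {I T : Type*} [Fintype T] [DecidableEq T]
    {r : I → T → ℕ} {σ : Finset T} {n : ℕ} (hn : #σ + 1 = n)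
    [DecidablePred (Dominant r)] (Y : Finset T)
    (hY : ∀ y, y ∈ Y ↔ y ∉ σ ∧ Dominant r (insert y σ)) :
    #(univ.filter fun τ : Finset T => (#τ = n ∧ Dominant r τ) ∧ σ ⊆ τ) = #Y := by
  symm
  refine card_bij (fun y _ => insert y σ) (fun y hy => ?_) (fun y hy z hz h => ?_) fun τ hτ => ?_
  · obtain ⟨h1, h2⟩ := (hY y).1 hy
    simp [h1, h2, hn]
  · have h1 := ((hY y).1 hy).1
    have : y ∈ insert z σ := h ▸ mem_insert_self y σ
    exact (mem_insert.1 this).resolve_right h1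
  · simp only [mem_filter, mem_univ, true_and] at hτ
    obtain ⟨⟨hc, hd⟩, hs⟩ := hτ
    obtain ⟨y, hy, rfl⟩ := (Finset.exists_eq_insert_iff).2 ⟨hs, by omega⟩
    exact ⟨y, (hY y).2 ⟨hy, hd⟩, rfl⟩

/-- A set of `|I|` points whose colours are exactly those different from `i₀` has exactly two
facets with the same set of colours. -/
theorem card_facets_eq_two {I T : Type*} [Fintype I] [DecidableEq I] [DecidableEq T]
    (c : T → I) (i₀ : I) {τ : Finset T} (hτ : #τ = Fintype.card I)
    (him : τ.image c = univ.erase i₀) :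
    #(τ.filter fun z => (τ.erase z).image c = univ.erase i₀) = 2 := by
  have hI : 0 < Fintype.card I := Fintype.card_pos_iff.2 ⟨i₀⟩
  have hc : #(univ.erase i₀) = Fintype.card I - 1 := by
    rw [card_erase_of_mem (mem_univ _), card_univ]
  obtain ⟨x, hx, y, hy, hxy, hcxy⟩ := Finset.exists_ne_map_eq_of_card_lt_of_maps_to
    (s := τ) (t := univ.erase i₀) (by omega) (f := c)
    (fun s hs => by rw [← him]; exact mem_image_of_mem c hs)
  have herase : ∀ x y, x ∈ τ → y ∈ τ → x ≠ y → c x = c y →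
      (τ.erase x).image c = univ.erase i₀ := fun x y hx hy hxy hcxy => by
    rw [← him]
    refine subset_antisymm (image_subset_image (erase_subset _ _)) fun k hk => ?_
    obtain ⟨s, hs, rfl⟩ := mem_image.1 hk
    by_cases hsx : s = x
    · exact mem_image.2 ⟨y, mem_erase.2 ⟨hxy.symm, hy⟩, by rw [hsx, hcxy]⟩
    · exact mem_image_of_mem c (mem_erase.2 ⟨hsx, hs⟩)
  rw [card_eq_two]
  refine ⟨x, y, hxy, ?_⟩
  ext z
  simp only [mem_filter, mem_insert, mem_singleton]
  constructor
  · rintro ⟨hz, hzim⟩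
    by_contra! hne
    have hinj : Set.InjOn c (τ.erase z) := card_image_iff.1 (by
      rw [hzim, hc, card_erase_of_mem hz, hτ])
    exact hxy (hinj (by simp [hx, hne.1.symm]) (by simp [hy, hne.2.symm]) hcxy)
  · rintro (rfl | rfl)
    · exact ⟨hx, herase _ y hx hy hxy hcxy⟩
    · exact ⟨hy, herase _ x hy hx hxy.symm hcxy.symm⟩

/-- **Scarf's lemma**, for a ground set containing a slack point `e i` for each order `i`. -/
theorem exists_dominant_colorful {I T : Type*} [Fintype I] [DecidableEq I] [Fintype T]
    [DecidableEq T] [Nontrivial I] (r : I → T → ℕ)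
    (hr : ∀ i, Function.Injective (r i)) (c : T → I) (e : I → T) (hce : ∀ i, c (e i) = i)
    (hmin : ∀ i x, x ≠ e i → r i (e i) < r i x)
    (hmax : ∀ i j x, i ≠ j → x ∉ Set.range e → r j x < r j (e i)) :
    ∃ σ : Finset T, Dominant r σ ∧ #σ = Fintype.card I ∧ σ.image c = univ := by
  classical
  by_contra! hcon
  obtain ⟨i₀⟩ : Nonempty I := inferInstance
  have he : Function.Injective e := fun i j h => by rw [← hce i, h, hce]
  have hI : 1 < Fintype.card I := Fintype.one_lt_card
  have hc : #(univ.erase i₀) = Fintype.card I - 1 := by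
    rw [card_erase_of_mem (mem_univ _), card_univ]
  let D : Finset (Finset T) := univ.filter fun σ =>
    (#σ + 1 = Fintype.card I ∧ Dominant r σ) ∧ σ.image c = univ.erase i₀
  let R : Finset (Finset T) := univ.filter fun τ =>
    (#τ = Fintype.card I ∧ Dominant r τ) ∧ τ.image c = univ.erase i₀
  let o : Finset T := (univ.erase i₀).image e
  have hoc : #o = Fintype.card I - 1 := by rw [card_image_of_injective _ he, hc]
  have hoD : o ∈ D := by
    simp only [D, mem_filter, mem_univ, true_and]
    refine ⟨⟨by omega, fun x => ?_⟩, ?_⟩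
    · by_cases hx : x ∈ Set.range e
      · obtain ⟨k, rfl⟩ := hx
        refine ⟨k, fun s _ => ?_⟩
        by_cases hs : s = e k
        · rw [hs]
        · exact (hmin k s hs).le
      · refine ⟨i₀, fun s hs => ?_⟩
        obtain ⟨k, hk, rfl⟩ := mem_image.1 hs
        exact (hmax k i₀ x (ne_of_mem_erase hk) hx).le
    · rw [image_image]
      have : c ∘ e = id := funext hce
      rw [this, image_id]
  have hRD : ∀ τ ∈ R, #(D.bipartiteBelow (· ⊆ ·) τ) = 2 := fun τ hτ => by
    simp only [R, mem_filter, mem_univ, true_and] at hτ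
    obtain ⟨⟨hcard, hd⟩, him⟩ := hτ
    rw [← card_facets_eq_two c i₀ hcard him]
    symm
    refine card_bij (fun z _ => τ.erase z) (fun z hz => ?_) (fun y hy z hz h => ?_)
      fun σ hσ => ?_
    · simp only [mem_filter] at hz
      simp only [bipartiteBelow, D, mem_filter, mem_univ, true_and]
      refine ⟨⟨⟨?_, hd.mono (erase_subset _ _)⟩, hz.2⟩, erase_subset _ _⟩
      rw [card_erase_of_mem hz.1]; omega
    · exact (erase_inj _ (mem_filter.1 hy).1).1 h
    · simp only [bipartiteBelow, D, mem_filter, mem_univ, true_and] at hσ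
      obtain ⟨⟨⟨h1, h2⟩, h3⟩, h4⟩ := hσ
      obtain ⟨y, hy, rfl⟩ := (Finset.exists_eq_insert_iff).2 ⟨h4, by omega⟩
      refine ⟨y, ?_, erase_insert hy⟩
      simp only [mem_filter, mem_insert_self, true_and, erase_insert hy, h3]
  have hRabove : ∀ σ ∈ D, R.bipartiteAbove (· ⊆ ·) σ =
      univ.filter fun τ : Finset T => (#τ = Fintype.card I ∧ Dominant r τ) ∧ σ ⊆ τ :=
      fun σ hσ => by
    simp only [D, mem_filter, mem_univ, true_and] at hσ
    ext τ
    simp only [bipartiteAbove, R, mem_filter, mem_univ, true_and]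
    refine ⟨fun h => ⟨h.1.1, h.2⟩, fun h => ⟨⟨h.1, ?_⟩, h.2⟩⟩
    have hsub : univ.erase i₀ ⊆ τ.image c := hσ.2 ▸ image_subset_image h.2
    by_contra hne
    apply hcon τ h.1.2 h.1.1
    rw [← card_eq_iff_eq_univ]
    have h1 := card_lt_card (hsub.ssubset_of_ne (Ne.symm hne))
    have h2 := card_le_univ (τ.image c)
    omega
  have hDR : ∀ σ ∈ D, #(R.bipartiteAbove (· ⊆ ·) σ) = if σ = o then 1 else 2 := fun σ hσ => by
    rw [hRabove σ hσ]
    simp only [D, mem_filter, mem_univ, true_and] at hσ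
    obtain ⟨⟨hcard, hd⟩, him⟩ := hσ
    obtain ⟨m, hmem, hmmin, a, b, hab, hmab, hiff, hnot⟩ := exists_extension_indices hr hd hcard
    split_ifs with ho
    · have hm : ∀ j, j ≠ i₀ → m j = e j := fun j hj => by
        by_contra hne
        have : e j ∈ σ := by rw [ho]; exact mem_image_of_mem e (by simpa using hj)
        exact absurd (hmmin j _ this) (not_le.2 (hmin j _ hne))
      have htop : ∃ y, IsTop r m i₀ y := exists_isTop (x := e i₀) fun j hj => by
        rw [hm j hj]
        exact hmin j _ fun h => hj (he h).symm
      have hntop : ∀ d, d ≠ i₀ → m i₀ = m d → ∀ y, ¬ IsTop r m d y := fun d hd hmd y hy => by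
        have h0 := hy.1 i₀ hd.symm
        rw [hmd, hm d hd] at h0
        by_cases hyr : y ∈ Set.range e
        · obtain ⟨k, rfl⟩ := hyr
          by_cases hk0 : k = i₀
          · subst hk0
            exact absurd (hmin k (e d) fun h => hd (he h)) h0.asymm
          · by_cases hkd : k = d
            · rw [hkd] at h0
              exact lt_irrefl _ h0
            · have := hy.1 k hkd
              rw [hm k hk0] at this
              exact lt_irrefl _ this
        · exact absurd (hmax d i₀ y hd hyr) h0.asymm
      obtain ⟨y, hy⟩ := htop
      rw [card_filter_dominant_superset hcard {y}, card_singleton]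
      intro z
      rw [hiff, mem_singleton]
      have hab0 : a = i₀ ∨ b = i₀ := by
        by_contra! h
        rw [hm a h.1, hm b h.2] at hmab
        exact hab (he hmab)
      rcases hab0 with rfl | rfl
      · exact ⟨fun h => Or.inl (h ▸ hy), fun h => h.elim (fun h => h.unique hr hy)
          fun h => absurd h (hntop b hab.symm hmab z)⟩
      · exact ⟨fun h => Or.inr (h ▸ hy), fun h => h.elim
          (fun h => absurd h (hntop a hab hmab.symm z)) fun h => h.unique hr hy⟩
    · have hne : ∀ i, ∃ y, IsTop r m i y := fun i => exists_isTop (x := e i) fun j hj => by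
        by_cases hmj : m j ∈ Set.range e
        · obtain ⟨k, hk⟩ := hmj
          by_cases hkj : k = j
          · rw [← hk, hkj]
            exact hmin j _ fun h => hj (he h).symm
          · exfalso
            apply ho
            have hsub : σ ⊆ (univ.erase j).image e := fun s hs => by
              have h1 := hmmin j s hs
              rw [← hk] at h1
              by_cases hsr : s ∈ Set.range e
              · obtain ⟨l, rfl⟩ := hsr
                refine mem_image_of_mem e (mem_erase.2 ⟨?_, mem_univ _⟩)
                rintro rfl
                exact absurd h1 (not_le.2 (hmin l _ fun h => hkj (he h)))
              · exact absurd h1 (not_le.2 (hmax k j s hkj hsr))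
            have hσj : σ = (univ.erase j).image e := eq_of_subset_of_card_le hsub (by
              rw [card_image_of_injective _ he, card_erase_of_mem (mem_univ _), card_univ]
              omega)
            have hji : j = i₀ := by
              by_contra hji
              have : j ∈ σ.image c := by rw [him]; simpa using hji
              rw [hσj, image_image] at this
              have hcid : c ∘ e = id := funext hce
              simp [hcid] at this
            rw [hσj, hji]
        · exact hmax i j _ (Ne.symm hj) hmj
      obtain ⟨y, hy⟩ := hne a
      obtain ⟨z, hz⟩ := hne b
      rw [card_filter_dominant_superset hcard {y, z}, card_pair]
      · rintro rfl
        exact hnot y ⟨hy, hz⟩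
      · intro x
        rw [hiff, mem_insert, mem_singleton]
        refine ⟨?_, fun h => h.imp (fun h => h.unique hr hy) fun h => h.unique hr hz⟩
        rintro (rfl | rfl)
        exacts [Or.inl hy, Or.inr hz]
  have hsum := Finset.sum_card_bipartiteAbove_eq_sum_card_bipartiteBelow (s := D) (t := R)
    (fun σ τ : Finset T => σ ⊆ τ)
  rw [sum_congr rfl hDR, sum_congr rfl hRD, ← add_sum_erase D _ hoD, if_pos rfl,
    sum_congr rfl (g := fun _ => 2) fun σ hσ => if_neg (ne_of_mem_erase hσ)] at hsum
  simp only [sum_const, smul_eq_mul] at hsum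
  omega

/-- A combinatorial form of Brouwer's fixed point theorem: for every colouring of the points
`x : I → ℕ` with `∑ i, x i = N` there is a point `x` such that every colour `i` with
`|I| < x i` occurs close to `x`. -/
theorem exists_near_all_colors {I : Type*} [Fintype I] [DecidableEq I] [Nontrivial I] (N : ℕ)
    (c : (I → ℕ) → I) :
    ∃ x : I → ℕ, ∑ i, x i = N ∧ ∀ i, x i ≤ Fintype.card I ∨
      ∃ y : I → ℕ, ∑ i, y i = N ∧ c y = i ∧
        ∀ k, y k ≤ x k + Fintype.card I ∧ x k ≤ y k + Fintype.card I := by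
  classical
  let G := {x // x ∈ piAntidiag (univ : Finset I) N}
  have hG : ∀ x : I → ℕ, x ∈ piAntidiag (univ : Finset I) N ↔ ∑ i, x i = N := by
    simp [mem_piAntidiag]
  let M := Fintype.card G
  let ν : G ≃ Fin M := Fintype.equivFin G
  let κ : I ≃ Fin (Fintype.card I) := Fintype.equivFin I
  let r : I → I ⊕ G → ℕ := fun i => Sum.elim
    (fun k => if k = i then 0 else (N + 1) * M + 1 + κ k) fun x => 1 + x.1 i * M + ν x
  have hxN : ∀ (x : G) i, x.1 i ≤ N := fun x i =>
    (single_le_sum (f := x.1) (fun _ _ => Nat.zero_le _) (mem_univ i)).trans_eq ((hG _).1 x.2)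
  have hlt : ∀ (x : G) i, 1 + x.1 i * M + ν x < (N + 1) * M + 1 := fun x i => by
    have h1 := (ν x).2
    have h2 := Nat.mul_le_mul_right M (hxN x i)
    rw [add_mul, one_mul]
    omega
  have hr : ∀ i, Function.Injective (r i) := fun i => by
    rintro (k | x) (l | y) h
    · simp only [r, Sum.elim_inl] at h
      split_ifs at h with h1 h2 h2
      · rw [h1, h2]
      · omega
      · omega
      · rw [κ.injective (Fin.ext (show (κ k : ℕ) = κ l by omega))]
    · simp only [r, Sum.elim_inl, Sum.elim_inr] at h
      have := hlt y i
      split_ifs at h <;> omega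
    · simp only [r, Sum.elim_inl, Sum.elim_inr] at h
      have := hlt x i
      split_ifs at h <;> omega
    · simp only [r, Sum.elim_inr] at h
      have h' : x.1 i * M + ν x = y.1 i * M + ν y := by omega
      have h1 := congrArg (· % M) h'
      simp only [Nat.mul_add_mod', Nat.mod_eq_of_lt (ν x).2,
        Nat.mod_eq_of_lt (ν y).2] at h1
      rw [ν.injective (Fin.ext h1)]
  have hrle : ∀ i (x y : G), r i (Sum.inr x) ≤ r i (Sum.inr y) → x.1 i ≤ y.1 i :=
      fun i x y h => by
    by_contra! hlt
    simp only [r, Sum.elim_inr] at h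
    have h1 := Nat.mul_le_mul_right M hlt
    have h2 := (ν y).2
    rw [Nat.succ_mul] at h1
    omega
  obtain ⟨σ, hσ, hcard, him⟩ := exists_dominant_colorful r hr
    (Sum.elim id fun x => c x.1) Sum.inl (fun _ => rfl)
    (by
      rintro i (k | x) h
      · have : k ≠ i := fun h' => h (congrArg _ h')
        simp [r, this]
      · simp only [r, Sum.elim_inl, Sum.elim_inr, if_true]
        omega)
    (by
      rintro i j (k | x) hij h
      · exact absurd ⟨k, rfl⟩ h
      · have := hlt x j
        simp only [r, Sum.elim_inl, Sum.elim_inr, if_neg hij]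
        omega)
  have hinj : Set.InjOn (Sum.elim id fun x : G => c x.1) σ := card_image_iff.1 (by
    rw [him, hcard, card_univ])
  let C : Finset I := univ.filter fun i => Sum.inl i ∉ σ
  have hdomC : ∀ x : G, ∃ i ∈ C, ∀ s : G, Sum.inr s ∈ σ → x.1 i ≤ s.1 i := fun x => by
    obtain ⟨i, hi⟩ := hσ (Sum.inr x)
    refine ⟨i, ?_, fun s hs => hrle _ _ _ (hi _ hs)⟩
    simp only [C, mem_filter, mem_univ, true_and]
    intro h
    have := hi _ h
    simp only [r, Sum.elim_inl, Sum.elim_inr, if_true] at this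
    omega
  obtain ⟨j₀⟩ : Nonempty I := inferInstance
  have hcolor : ∀ i ∈ C, ∃ s : G, Sum.inr s ∈ σ ∧ c s.1 = i := fun i hi => by
    have : i ∈ σ.image (Sum.elim id fun x : G => c x.1) := by
      rw [him]; exact mem_univ i
    obtain ⟨k | s, hs, hsi⟩ := mem_image.1 this
    · simp only [Sum.elim_inl, id] at hsi
      subst hsi
      simp [C, hs] at hi
    · exact ⟨s, hs, hsi⟩
  let S : Finset G := univ.filter fun s => Sum.inr s ∈ σ
  have hSne : S.Nonempty := by
    obtain ⟨i, hi, -⟩ := hdomC ⟨Pi.single j₀ N, (hG _).2 (by simp)⟩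
    obtain ⟨s, hs, -⟩ := hcolor i hi
    exact ⟨s, by simpa [S] using hs⟩
  choose q hqS hq using fun i => S.exists_min_image (fun s => s.1 i) hSne
  have hqsum : N < ∑ i ∈ C, ((q i).1 i + 1) := by
    by_contra! hle
    let x : I → ℕ := (fun i => if i ∈ C then (q i).1 i + 1 else 0) +
      Pi.single j₀ (N - ∑ i ∈ C, ((q i).1 i + 1))
    have hx : ∑ i, x i = N := by
      simp only [x, Pi.add_apply]
      rw [sum_add_distrib, sum_pi_single', if_pos (mem_univ _), sum_ite_mem, univ_inter]
      omega
    obtain ⟨i, hi, hmin⟩ := hdomC ⟨x, (hG x).2 hx⟩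
    have h1 := hmin (q i) (by simpa [S] using hqS i)
    simp only [x, Pi.add_apply, if_pos hi] at h1
    omega
  have hbound : ∀ s ∈ S, (∀ i ∈ C, (q i).1 i ≤ s.1 i ∧ s.1 i ≤ (q i).1 i + Fintype.card I) ∧
      ∀ i, i ∉ C → s.1 i ≤ Fintype.card I := fun s hs => by
    have hsN := (hG _).1 s.2
    have hCcard : #C ≤ Fintype.card I := card_le_univ C
    rw [sum_add_distrib, sum_const, smul_eq_mul, mul_one] at hqsum
    have hlow : ∀ i ∈ C, (q i).1 i ≤ s.1 i := fun i _ => hq i s hs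
    rw [← sum_add_sum_compl C] at hsN
    refine ⟨fun i hi => ⟨hlow i hi, ?_⟩, fun i hi => ?_⟩
    · rw [← add_sum_erase C _ hi] at hqsum hsN
      have := sum_le_sum fun k (hk : k ∈ C.erase i) => hlow k (mem_of_mem_erase hk)
      omega
    · have h1 := sum_le_sum hlow
      have h2 := single_le_sum (f := s.1) (fun _ _ => Nat.zero_le _) (mem_compl.2 hi)
      omega
  obtain ⟨s, hs⟩ := hSne
  refine ⟨s.1, (hG _).1 s.2, fun i => ?_⟩
  by_cases hi : i ∈ C
  · obtain ⟨t, ht, hti⟩ := hcolor i hi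
    have htS : t ∈ S := by simpa [S] using ht
    refine Or.inr ⟨t.1, (hG _).1 t.2, hti, fun k => ?_⟩
    by_cases hk : k ∈ C
    · have h1 := (hbound s hs).1 k hk
      have h2 := (hbound t htS).1 k hk
      omega
    · have h1 := (hbound s hs).2 k hk
      have h2 := (hbound t htS).2 k hk
      omega
  · exact Or.inl ((hbound s hs).2 i hi)

end Scarf

/-- **Brouwer's fixed point theorem** for the standard simplex. -/
theorem exists_fixed_point_stdSimplex {I : Type*} [Fintype I] [Nonempty I]
    (f : (I → ℝ) → I → ℝ) (hf : ContinuousOn f (stdSimplex ℝ I))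
    (hmaps : Set.MapsTo f (stdSimplex ℝ I) (stdSimplex ℝ I)) :
    ∃ x ∈ stdSimplex ℝ I, f x = x := by
  classical
  have hne : (stdSimplex ℝ I).Nonempty := ⟨_, single_mem_stdSimplex ℝ (Classical.arbitrary I)⟩
  have hcpt : IsCompact (stdSimplex ℝ I) := isCompact_stdSimplex ℝ I
  rcases subsingleton_or_nontrivial I with hI | hI
  · obtain ⟨x, hx⟩ := hne
    refine ⟨x, hx, funext fun i => ?_⟩
    have h1 := (hmaps hx).2
    have h2 := hx.2
    rw [Fintype.sum_subsingleton _ i] at h1 h2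
    rw [h1, h2]
  have happrox : ∀ ε > 0, ∃ x ∈ stdSimplex ℝ I, ∀ i, x i - f x i ≤ ε := fun ε hε => by
    obtain ⟨δ, hδ, hfδ⟩ := Metric.uniformContinuousOn_iff.1
      (hcpt.uniformContinuousOn_of_continuous hf) (ε / 2) (by positivity)
    obtain ⟨N, hN⟩ := exists_nat_gt (Fintype.card I / min δ (ε / 2))
    have hmin : 0 < min δ (ε / 2) := by positivity
    have hN0 : (0 : ℝ) < N := lt_of_le_of_lt (by positivity) hN
    have hcN : (Fintype.card I : ℝ) / N < min δ (ε / 2) := by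
      rw [div_lt_iff₀ hmin] at hN
      rw [div_lt_iff₀ hN0]
      linarith
    let p : (I → ℕ) → I → ℝ := fun x i => x i / N
    have hp : ∀ x : I → ℕ, ∑ i, x i = N → p x ∈ stdSimplex ℝ I := fun x hx => by
      refine ⟨fun i => by positivity, ?_⟩
      simp only [p]
      rw [← Finset.sum_div, ← Nat.cast_sum, hx, div_self hN0.ne']
    have hcol : ∀ x : I → ℕ, ∃ i, p x ∈ stdSimplex ℝ I → p x i ≤ f (p x) i := fun x => by
      by_contra! hlt
      have hx := (hlt (Classical.arbitrary I)).1
      have := Finset.sum_lt_sum_of_nonempty (s := Finset.univ) Finset.univ_nonempty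
        fun i _ => (hlt i).2
      rw [hx.2, (hmaps hx).2] at this
      exact lt_irrefl _ this
    choose c hc using hcol
    obtain ⟨x, hx, hxc⟩ := Scarf.exists_near_all_colors N c
    refine ⟨p x, hp x hx, fun i => ?_⟩
    rcases hxc i with h | ⟨y, hy, rfl, hxy⟩
    · have h1 : p x i ≤ Fintype.card I / N := by
        simp only [p]
        gcongr
      have h2 := (hmaps (hp x hx)).1 i
      have h3 := min_le_right δ (ε / 2)
      linarith
    · have habs : ∀ k, dist (p x k) (p y k) ≤ Fintype.card I / N := fun k => by
        have h1 : (y k : ℝ) ≤ x k + Fintype.card I := by exact_mod_cast (hxy k).1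
        have h2 : (x k : ℝ) ≤ y k + Fintype.card I := by exact_mod_cast (hxy k).2
        simp only [p]
        rw [Real.dist_eq, ← sub_div, abs_div, abs_of_pos hN0]
        gcongr
        rw [abs_le]
        constructor <;> linarith
      have hdist : dist (p x) (p y) < δ :=
        ((dist_pi_le_iff (by positivity)).2 habs).trans_lt (hcN.trans_le (min_le_left _ _))
      have h1 := (dist_le_pi_dist _ _ (c y)).trans (hfδ _ (hp x hx) _ (hp y hy) hdist).le
      have h2 := (habs (c y)).trans (hcN.le.trans (min_le_right _ _))
      have h3 := hc y (hp y hy)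
      rw [Real.dist_eq, abs_le] at h1 h2
      linarith [h1.1, h2.2]
  have hfi : ∀ i, ContinuousOn (fun x => x i - f x i) (stdSimplex ℝ I) := fun i =>
    (continuous_apply i).continuousOn.sub ((continuous_apply i).comp_continuousOn hf)
  obtain ⟨x, hx, hmin⟩ := hcpt.exists_isMinOn hne
    (ContinuousOn.finset_sup'_apply Finset.univ_nonempty fun i _ => hfi i)
  have hle : ∀ i, x i ≤ f x i := fun i => by
    refine le_of_forall_pos_le_add fun ε hε => ?_
    obtain ⟨y, hy, hyε⟩ := happrox ε hε
    have h1 := Finset.le_sup' (fun i => x i - f x i) (Finset.mem_univ i)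
    have h2 := isMinOn_iff.1 hmin y hy
    have h3 := Finset.sup'_le (s := Finset.univ) Finset.univ_nonempty (fun i => y i - f y i)
      fun i _ => hyε i
    linarith [h1.trans (h2.trans h3)]
  refine ⟨x, hx, funext fun i => ?_⟩
  have hsum : ∑ i, x i = ∑ i, f x i := by rw [hx.2, (hmaps hx).2]
  exact (((Finset.sum_eq_sum_iff_of_le fun i _ => hle i).1 hsum) i (Finset.mem_univ i)).symm

/-- **Browder's selection argument**: a map with convex values which admits locally constant
selections in a compact convex set `K` has a fixed point in `K`. -/
theorem exists_mem_of_locally_constant_selection {X : Type*} [NormedAddCommGroup X]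
    [NormedSpace ℝ X] {K : Set X} (hKne : K.Nonempty) (hKcp : IsCompact K) (hKconv : Convex ℝ K)
    {P : X → Set X} (hconv : ∀ x ∈ K, Convex ℝ (P x))
    (hsel : ∀ x ∈ K, ∃ y ∈ K, ∃ W, IsOpen W ∧ x ∈ W ∧ ∀ x' ∈ W, y ∈ P x') :
    ∃ x ∈ K, x ∈ P x := by
  classical
  choose! y hyK W hWo hxW hyP using hsel
  obtain ⟨s, hsK, hs⟩ := hKcp.elim_nhds_subcover W fun x hx => (hWo x hx).mem_nhds (hxW x hx)
  obtain ⟨ρ, hρ⟩ := PartitionOfUnity.exists_isSubordinate hKcp.isClosed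
    (fun i : s => W i) (fun i => hWo i (hsK i i.2))
    (by simpa [Set.iUnion_subtype] using hs)
  have hsum : ∀ x ∈ K, ∑ i, ρ i x = 1 := fun x hx => by
    rw [← finsum_eq_sum_of_fintype]
    exact ρ.sum_eq_one hx
  let L : (s → ℝ) → X := fun l => ∑ i, l i • y i
  have hLK : ∀ l ∈ stdSimplex ℝ s, L l ∈ K := fun l hl =>
    hKconv.sum_mem (fun i _ => hl.1 i) hl.2 fun i _ => hyK i (hsK i i.2)
  have : Nonempty s := by
    obtain ⟨x, hx⟩ := hKne
    obtain ⟨i, hi, -⟩ := Set.mem_iUnion₂.1 (hs hx)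
    exact ⟨⟨i, hi⟩⟩
  obtain ⟨l, hl, hfix⟩ := exists_fixed_point_stdSimplex (fun l i => ρ i (L l))
    (Continuous.continuousOn (by fun_prop))
    fun l hl => ⟨fun i => ρ.nonneg i _, hsum _ (hLK l hl)⟩
  refine ⟨L l, hLK l hl, ?_⟩
  have hmem := (hconv _ (hLK l hl)).finsum_mem (w := l) (z := fun i : s => y i) hl.1
    (by rw [finsum_eq_sum_of_fintype]; exact hl.2) fun i hi => by
      rw [← hfix] at hi
      exact hyP i (hsK i i.2) _ (hρ i (subset_tsupport _ hi))
  rwa [finsum_eq_sum_of_fintype] at hmem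

/-- if `K` is a nonempty compact convex subset of a Banach space `X` and
`P : X ⇉ X` is convex-valued, mid-point continuous at every `x ∈ X`, and satisfies
`x ∉ P(x)` for all `x`, then `P` has a maximal element over `K`: some `xb ∈ K` with
`P(xb) ∩ K = ∅`. -/
theorem exists_maximal_element {X : Type*}
    [NormedAddCommGroup X] [NormedSpace ℝ X] [CompleteSpace X]
    (K : Set X) (hKne : K.Nonempty) (hKcp : IsCompact K) (hKconv : Convex ℝ K)
    (P : X → Set X)
    (hconv : ∀ x : X, Convex ℝ (P x))
    -- mid-point continuity of `P` at every `x ∈ X`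
    (hmc : ∀ x : X, ∀ w ∈ P x, ∃ t : ℝ, t ∈ Set.Ico (0 : ℝ) 1 ∧
      ∃ V : Set X, ∃ W : Set X, IsOpen V ∧ IsOpen W ∧
        t • x + (1 - t) • w ∈ V ∧ x ∈ W ∧
        ∀ w' ∈ V, ∀ x' ∈ W, w' ∈ P x')
    (hirr : ∀ x : X, x ∉ P x) :
    ∃ xb ∈ K, P xb ∩ K = ∅ := by
  by_contra! hne
  obtain ⟨x, -, hx⟩ := exists_mem_of_locally_constant_selection hKne hKcp hKconv
    (fun x _ => hconv x) fun x hx => by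
      obtain ⟨w, hwP, hwK⟩ := hne x hx
      obtain ⟨t, ht, V, W, -, hW, hV, hxW, h⟩ := hmc x w hwP
      exact ⟨_, hKconv hx hwK ht.1 (sub_nonneg.2 ht.2.le) (add_sub_cancel _ _), W, hW, hxW,
        h _ hV⟩
  exact hirr x hx
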